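/- Let L be a finite semidistrim lattice with rowmotion Row_L. For x ∈ L, one has Row_L(x) ≤ x if and only if D_L(x) is an independent dominating set of the undirected Galois graph G̃_L. Consequently, |{x ∈ L : Row_L(x) ≤ x}| = |Pop↓(L)| = |Pop↑(L)| = the number of independent dominating sets of G̃_L, where Pop↓(L) and Pop↑(L) denote the images of the pop-stack sorting and dual pop-stack sorting operators. -/

import Mathlib

universe u

/-- An element of a lattice is join-irreducible if it covers exactly one element. -/
def JoinIrred {α : Type u} [Lattice α] (j : α) : Prop := ∃! y : α, y ⋖ j

/-- An element of a lattice is meet-irreducible if it is covered by exactly one element. -/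
def MeetIrred {α : Type u} [Lattice α] (m : α) : Prop := ∃! y : α, m ⋖ y

/-- `j` is join-prime if `j ≤ x ⊔ y` implies `j ≤ x` or `j ≤ y`. -/
def JoinPrime {α : Type u} [Lattice α] (j : α) : Prop :=
  ∀ x y : α, j ≤ x ⊔ y → j ≤ x ∨ j ≤ y

/-- `m` is meet-prime if `x ⊓ y ≤ m` implies `x ≤ m` or `y ≤ m`. -/
def MeetPrime {α : Type u} [Lattice α] (m : α) : Prop :=
  ∀ x y : α, x ⊓ y ≤ m → x ≤ m ∨ y ≤ m

/-- `(j0, m0)` is a prime pair: the lattice is the disjoint union of `[⊥, m0]` and `[j0, ⊤]`,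
i.e. every element satisfies exactly one of `z ≤ m0` or `j0 ≤ z`. -/
def IsPrimePair {α : Type u} [Lattice α] (j0 m0 : α) : Prop :=
  ∀ z : α, (z ≤ m0 ∨ j0 ≤ z) ∧ ¬(z ≤ m0 ∧ j0 ≤ z)

/-- A pairing is a bijection `κ` from join-irreducibles to meet-irreducibles such that
`κ j` is maximal in `{z | j ⊓ z = j_*}` and `j = κ⁻¹ (κ j)` is minimal in
`{z | κ j ⊔ z = (κ j)^*}`. -/
def IsPairing {α : Type u} [Lattice α]
    (κ : {j : α // JoinIrred j} → {m : α // MeetIrred m}) : Prop :=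
  Function.Bijective κ ∧
    (∀ (j : {j : α // JoinIrred j}) (jst : α), jst ⋖ j.1 →
      Maximal (fun z : α => j.1 ⊓ z = jst) (κ j).1) ∧
    (∀ (j : {j : α // JoinIrred j}) (mst : α), (κ j).1 ⋖ mst →
      Minimal (fun z : α => (κ j).1 ⊔ z = mst) j.1)

/-- The edge relation of the Galois graph: `j → j'` iff `j ≠ j'` and `j ≰ κ j'`. -/
def GaloisEdge {α : Type u} [Lattice α]
    (κ : {j : α // JoinIrred j} → {m : α // MeetIrred m})
    (j j' : {j : α // JoinIrred j}) : Prop :=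
  j ≠ j' ∧ ¬ j.1 ≤ (κ j').1

/-- Independent sets of the Galois graph (no edge in either direction). -/
def IndepSet {α : Type u} [Lattice α]
    (κ : {j : α // JoinIrred j} → {m : α // MeetIrred m})
    (S : Set {j : α // JoinIrred j}) : Prop :=
  ∀ j ∈ S, ∀ j' ∈ S, ¬ GaloisEdge κ j j'

/-- The downward label set `D_L(x)`: labels of the cover relations `y ⋖ x`. -/
def DLabel {α : Type u} [Lattice α]
    (κ : {j : α // JoinIrred j} → {m : α // MeetIrred m}) (x : α) :
    Set {j : α // JoinIrred j} :=
  {j | ∃ y : α, y ⋖ x ∧ j.1 ≤ x ∧ y ≤ (κ j).1}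

/-- The upward label set `U_L(x)`: labels of the cover relations `x ⋖ y`. -/
def ULabel {α : Type u} [Lattice α]
    (κ : {j : α // JoinIrred j} → {m : α // MeetIrred m}) (x : α) :
    Set {j : α // JoinIrred j} :=
  {j | ∃ y : α, x ⋖ y ∧ j.1 ≤ y ∧ x ≤ (κ j).1}

/-- A uniquely paired lattice is overlapping if every cover relation has a unique label. -/
def Overlapping {α : Type u} [Lattice α]
    (κ : {j : α // JoinIrred j} → {m : α // MeetIrred m}) : Prop :=
  ∀ x y : α, x ⋖ y → ∃! j : {j : α // JoinIrred j}, j.1 ≤ y ∧ x ≤ (κ j).1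

/-- Compatibly dismantlable lattices: either a one-element lattice, or a uniquely paired
lattice with a prime pair `(j0, m0)` whose intervals `[j0, ⊤] = Set.Ici j0` and
`[⊥, m0] = Set.Iic m0` are compatibly dismantlable, together with the compatibility
conditions relating the unique pairings via `α j = j0 ⊔ j` and `β m = m0 ⊓ m`. -/
inductive CompatiblyDismantlable : (β : Type u) → [Lattice β] → [Finite β] → Prop
  | singleton (β : Type u) [Lattice β] [Finite β] (h : Nat.card β = 1) :
      CompatiblyDismantlable β
  | step (β : Type u) [Lattice β] [Finite β]
      (κ : {j : β // JoinIrred j} → {m : β // MeetIrred m})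
      (hκ : IsPairing κ) (huniq : ∀ κ', IsPairing κ' → κ' = κ)
      (j0 m0 : β) (hpp : IsPrimePair j0 m0)
      (hup : CompatiblyDismantlable ↥(Set.Ici j0))
      (hdn : CompatiblyDismantlable ↥(Set.Iic m0))
      (κup : {j : ↥(Set.Ici j0) // JoinIrred j} → {m : ↥(Set.Ici j0) // MeetIrred m})
      (hκup : IsPairing κup) (hκupuniq : ∀ κ', IsPairing κ' → κ' = κup)
      (κdn : {j : ↥(Set.Iic m0) // JoinIrred j} → {m : ↥(Set.Iic m0) // MeetIrred m})
      (hκdn : IsPairing κdn) (hκdnuniq : ∀ κ', IsPairing κ' → κ' = κdn)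
      (halpha : ∀ j : {j : β // JoinIrred j}, j0 ≤ (κ j).1 →
          ∃ hji : JoinIrred (⟨j0 ⊔ j.1, Set.mem_Ici.mpr le_sup_left⟩ : ↥(Set.Ici j0)),
            (κup ⟨⟨j0 ⊔ j.1, Set.mem_Ici.mpr le_sup_left⟩, hji⟩).1.1 = (κ j).1)
      (halphainj : ∀ j j' : {j : β // JoinIrred j}, j0 ≤ (κ j).1 → j0 ≤ (κ j').1 →
          j0 ⊔ j.1 = j0 ⊔ j'.1 → j = j')
      (halphasurj : ∀ j' : {j : ↥(Set.Ici j0) // JoinIrred j},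
          ∃ j : {j : β // JoinIrred j}, j0 ≤ (κ j).1 ∧ j0 ⊔ j.1 = j'.1.1)
      (hbeta : ∀ (j : {j : β // JoinIrred j}) (h : j.1 ≤ m0),
          ∃ hji : JoinIrred (⟨j.1, Set.mem_Iic.mpr h⟩ : ↥(Set.Iic m0)),
            (κdn ⟨⟨j.1, Set.mem_Iic.mpr h⟩, hji⟩).1.1 = m0 ⊓ (κ j).1)
      (hbetainj : ∀ j j' : {j : β // JoinIrred j}, j.1 ≤ m0 → j'.1 ≤ m0 →
          m0 ⊓ (κ j).1 = m0 ⊓ (κ j').1 → j = j')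
      (hbetasurj : ∀ m' : {m : ↥(Set.Iic m0) // MeetIrred m},
          ∃ j : {j : β // JoinIrred j}, j.1 ≤ m0 ∧ m0 ⊓ (κ j).1 = m'.1.1) :
      CompatiblyDismantlable β

/-- A lattice is semidistrim if it is compatibly dismantlable and the downward and upward
label sets of every element are independent sets of the Galois graph. -/
def Semidistrim (β : Type u) [Lattice β] [Finite β] : Prop :=
  CompatiblyDismantlable β ∧
    ∀ κ : {j : β // JoinIrred j} → {m : β // MeetIrred m}, IsPairing κ →
      ∀ x : β, IndepSet κ (DLabel κ x) ∧ IndepSet κ (ULabel κ x)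

/-- The pop-stack sorting operator `Pop↓(x) = x ⊓ ⋀{y | y ⋖ x}`. -/
def PopDown {α : Type u} [CompleteLattice α] (x : α) : α := x ⊓ sInf {y : α | y ⋖ x}

/-- The dual pop-stack sorting operator `Pop↑(x) = x ⊔ ⋁{y | x ⋖ y}`. -/
def PopUp {α : Type u} [CompleteLattice α] (x : α) : α := x ⊔ sSup {y : α | x ⋖ y}

/-- An independent dominating set of the undirected Galois graph: an independent set `S`
such that every vertex not in `S` is adjacent (in some direction) to an element of `S`. -/
def IndepDom {α : Type u} [Lattice α]
    (κ : {j : α // JoinIrred j} → {m : α // MeetIrred m})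
    (S : Set {j : α // JoinIrred j}) : Prop :=
  IndepSet κ S ∧
    ∀ j, j ∉ S → ∃ j' ∈ S, GaloisEdge κ j j' ∨ GaloisEdge κ j' j

theorem aux_ici_cov {β : Type u} [Lattice β] {c : β} {a b : ↥(Set.Ici c)} :
    a ⋖ b ↔ a.1 ⋖ b.1 := by
  constructor
  · intro h
    refine ⟨h.1, fun z h1 h2 => ?_⟩
    exact h.2 (c := ⟨z, Set.mem_Ici.mpr (le_trans a.2 h1.le)⟩) h1 h2
  · intro h
    exact ⟨h.1, fun z h1 h2 => h.2 (c := z.1) h1 h2⟩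

theorem aux_iic_cov {β : Type u} [Lattice β] {c : β} {a b : ↥(Set.Iic c)} :
    a ⋖ b ↔ a.1 ⋖ b.1 := by
  constructor
  · intro h
    refine ⟨h.1, fun z h1 h2 => ?_⟩
    exact h.2 (c := ⟨z, Set.mem_Iic.mpr (le_trans h2.le b.2)⟩) h1 h2
  · intro h
    exact ⟨h.1, fun z h1 h2 => h.2 (c := z.1) h1 h2⟩

/-- Properties of compatibly dismantlable lattices used below. -/
def AuxProp {β : Type u} [Lattice β]
    (κ : {j : β // JoinIrred j} → {m : β // MeetIrred m}) : Prop :=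
  (∀ x y : β, x ⋖ y → ∃ j : {j : β // JoinIrred j}, j.1 ≤ y ∧ x ≤ (κ j).1) ∧
  (∀ (j : {j : β // JoinIrred j}) (w : β), w ≤ (κ j).1 →
    (w ⊔ j.1) ⊓ (κ j).1 ⋖ w ⊔ j.1) ∧
  (∀ (j : {j : β // JoinIrred j}) (v : β), j.1 ≤ v →
    v ⊓ (κ j).1 ⋖ (v ⊓ (κ j).1) ⊔ j.1)

theorem aux_not_le {β : Type u} [Lattice β]
    {κ : {j : β // JoinIrred j} → {m : β // MeetIrred m}} (hκ : IsPairing κ)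
    (j : {j : β // JoinIrred j}) : ¬ j.1 ≤ (κ j).1 := by
  intro h
  obtain ⟨y, hy, -⟩ := j.2
  have h1 : j.1 ⊓ (κ j).1 = y := (hκ.2.1 j y hy).prop
  rw [inf_eq_left.mpr h] at h1
  exact hy.1.ne h1.symm

theorem aux_main (β : Type u) [Lattice β] [Finite β] (h : CompatiblyDismantlable β) :
    ∀ κ : {j : β // JoinIrred j} → {m : β // MeetIrred m}, IsPairing κ → AuxProp κ := by
  induction h with
  | singleton β h =>
    intro κ _
    have hs : Subsingleton β := (Nat.card_eq_one_iff_unique.mp h).1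
    have hc : ∀ x y : β, ¬ x ⋖ y := fun x y hxy => hxy.1.ne (Subsingleton.elim x y)
    have hj : ∀ j : {j : β // JoinIrred j}, False := fun j => by
      obtain ⟨y, hy, -⟩ := j.2
      exact hc _ _ hy
    exact ⟨fun x y hxy => (hc _ _ hxy).elim, fun j => (hj j).elim, fun j => (hj j).elim⟩
  | step β κ hκ huniq j0 m0 hpp hup hdn κup hκup hκupuniq κdn hκdn hκdnuniq halpha halphainj
      halphasurj hbeta hbetainj hbetasurj ihup ihdn =>
    intro κ' hκ'
    obtain rfl := huniq κ' hκ'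
    obtain ⟨U1, U2, U3⟩ := ihup κup hκup
    obtain ⟨D1, D2, D3⟩ := ihdn κdn hκdn
    have hor : ∀ z, z ≤ m0 ∨ j0 ≤ z := fun z => (hpp z).1
    have hnot : ∀ z, z ≤ m0 → j0 ≤ z → False := fun z h1 h2 => (hpp z).2 ⟨h1, h2⟩
    have hcov0 : j0 ⊓ m0 ⋖ j0 := by
      refine ⟨lt_of_le_of_ne inf_le_left fun h => hnot j0 (inf_eq_left.mp h) le_rfl, ?_⟩
      intro z h1 h2
      rcases hor z with h | h
      · exact absurd h1 (not_lt_of_ge (le_inf h2.le h))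
      · exact absurd h2 (not_lt_of_ge h)
    have hj0 : JoinIrred j0 := by
      refine ⟨j0 ⊓ m0, hcov0, ?_⟩
      intro y hy
      have hym : y ≤ m0 := (hor y).resolve_right fun h => absurd hy.1 (not_lt_of_ge h)
      by_contra hne
      exact hy.2 (lt_of_le_of_ne (le_inf hy.1.le hym) hne) hcov0.1
    have hκ0 : (κ' ⟨j0, hj0⟩).1 = m0 := by
      have hmax := hκ.2.1 ⟨j0, hj0⟩ (j0 ⊓ m0) hcov0
      have hle : (κ' ⟨j0, hj0⟩).1 ≤ m0 := by
        refine (hor _).resolve_right fun h => ?_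
        exact aux_not_le hκ ⟨j0, hj0⟩ h
      exact le_antisymm hle (hmax.2 rfl hle)
    have hbig : ∀ j : {j : β // JoinIrred j}, j0 ≤ j.1 → j.1 = j0 ∨ j0 ≤ (κ' j).1 := by
      intro j hj
      by_cases he : j.1 = j0
      · exact Or.inl he
      right
      have hlt : j0 < j.1 := lt_of_le_of_ne hj (Ne.symm he)
      obtain ⟨y, hy, hyu⟩ := j.2
      obtain ⟨z, hz1, hz2⟩ := exists_le_covBy_of_lt hlt
      obtain rfl := hyu z hz2
      have h1 : j.1 ⊓ (κ' j).1 = z := (hκ.2.1 j z hz2).prop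
      calc j0 ≤ z := hz1
        _ = j.1 ⊓ (κ' j).1 := h1.symm
        _ ≤ _ := inf_le_right
    refine ⟨?_, ?_, ?_⟩
    · intro x y hxy
      rcases hor x with hx | hx
      · rcases hor y with hy | hy
        · obtain ⟨j', h1, h2⟩ := D1 ⟨x, hx⟩ ⟨y, hy⟩ (aux_iic_cov.mpr hxy)
          obtain ⟨j, hjm, hje⟩ := hbetasurj (κdn j')
          obtain ⟨hji, hk⟩ := hbeta j hjm
          have e1 : κdn ⟨⟨j.1, Set.mem_Iic.mpr hjm⟩, hji⟩ = κdn j' :=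
            Subtype.ext (Subtype.ext (hk.trans hje))
          have e2 := hκdn.1.1 e1
          subst e2
          refine ⟨j, h1, ?_⟩
          have h3 : x ≤ m0 ⊓ (κ' j).1 := hk ▸ h2
          exact h3.trans inf_le_right
        · exact ⟨⟨j0, hj0⟩, hy, hκ0.symm ▸ hx⟩
      · have hy : j0 ≤ y := hx.trans hxy.1.le
        obtain ⟨j', h1, h2⟩ := U1 ⟨x, hx⟩ ⟨y, hy⟩ (aux_ici_cov.mpr hxy)
        obtain ⟨j, hjm, hje⟩ := halphasurj j'
        obtain ⟨hji, hk⟩ := halpha j hjm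
        have e2 : (⟨⟨j0 ⊔ j.1, Set.mem_Ici.mpr le_sup_left⟩, hji⟩ :
            {j : ↥(Set.Ici j0) // JoinIrred j}) = j' := Subtype.ext (Subtype.ext hje)
        subst e2
        refine ⟨j, le_trans le_sup_right (show j0 ⊔ j.1 ≤ y from h1), ?_⟩
        have h3 : x ≤ (κ' j).1 := hk ▸ h2
        exact h3
    · have hUp : ∀ (j : {j : β // JoinIrred j}) (w : β), w ≤ (κ' j).1 → j0 ≤ (κ' j).1 →
          j0 ≤ w → (w ⊔ j.1) ⊓ (κ' j).1 ⋖ w ⊔ j.1 := by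
        intro j w hw h0 hw0
        obtain ⟨hji, hk⟩ := halpha j h0
        have h3 := U2 ⟨_, hji⟩ ⟨w, hw0⟩ (show w ≤ _ by rw [hk]; exact hw)
        have h4 := aux_ici_cov.mp h3
        have h5 : (w ⊔ (j0 ⊔ j.1)) ⊓ (κ' j).1 ⋖ w ⊔ (j0 ⊔ j.1) := by
          rw [← hk]; exact h4
        have h6 : w ⊔ (j0 ⊔ j.1) = w ⊔ j.1 := by rw [← sup_assoc, sup_eq_left.mpr hw0]
        rwa [h6] at h5
      intro j w hw
      rcases hor j.1 with hj | hj
      · rcases hor w with hwm | hwm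
        · obtain ⟨hji, hk⟩ := hbeta j hj
          have h3 := D2 ⟨_, hji⟩ ⟨w, hwm⟩ (show w ≤ _ by rw [hk]; exact le_inf hwm hw)
          have h4 := aux_iic_cov.mp h3
          have h5 : (w ⊔ j.1) ⊓ (m0 ⊓ (κ' j).1) ⋖ w ⊔ j.1 := by
            rw [← hk]; exact h4
          rwa [← inf_assoc, inf_eq_left.mpr (sup_le hwm hj)] at h5
        · exact hUp j w hw (hwm.trans hw) hwm
      · rcases hbig j hj with he | hk
        · have he' : j = ⟨j0, hj0⟩ := Subtype.ext he
          subst he'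
          rw [hκ0] at hw ⊢
          refine ⟨lt_of_le_of_ne inf_le_left fun h =>
            hnot (w ⊔ j0) (inf_eq_left.mp h) le_sup_right, ?_⟩
          intro z h1 h2
          rcases hor z with h | h
          · exact absurd h1 (not_lt_of_ge (le_inf h2.le h))
          · refine absurd h2 (not_lt_of_ge (sup_le ?_ h))
            exact (le_inf le_sup_left hw).trans h1.le
        · have h3 := hUp j (w ⊔ j0) (sup_le hw hk) hk le_sup_right
          rwa [sup_assoc, sup_eq_right.mpr hj] at h3
    · have hUp : ∀ (j : {j : β // JoinIrred j}) (v : β), j.1 ≤ v → j0 ≤ (κ' j).1 →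
          j0 ≤ v → v ⊓ (κ' j).1 ⋖ (v ⊓ (κ' j).1) ⊔ j.1 := by
        intro j v hv h0 hv0
        obtain ⟨hji, hk⟩ := halpha j h0
        have h3 := U3 ⟨_, hji⟩ ⟨v, hv0⟩ (show j0 ⊔ j.1 ≤ v from sup_le hv0 hv)
        have h4 := aux_ici_cov.mp h3
        have h5 : v ⊓ (κ' j).1 ⋖ (v ⊓ (κ' j).1) ⊔ (j0 ⊔ j.1) := by
          rw [← hk]; exact h4
        rwa [← sup_assoc, sup_eq_left.mpr (le_inf hv0 h0)] at h5
      have hDn : ∀ (j : {j : β // JoinIrred j}) (v : β), j.1 ≤ v → j.1 ≤ m0 →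
          v ≤ m0 → v ⊓ (κ' j).1 ⋖ (v ⊓ (κ' j).1) ⊔ j.1 := by
        intro j v hv hj hvm
        obtain ⟨hji, hk⟩ := hbeta j hj
        have h3 := D3 ⟨_, hji⟩ ⟨v, hvm⟩ (show j.1 ≤ v from hv)
        have h4 := aux_iic_cov.mp h3
        have h5 : v ⊓ (m0 ⊓ (κ' j).1) ⋖ (v ⊓ (m0 ⊓ (κ' j).1)) ⊔ j.1 := by
          rw [← hk]; exact h4
        rwa [← inf_assoc, inf_eq_left.mpr hvm] at h5
      intro j v hv
      rcases hor j.1 with hj | hj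
      · rcases hor v with hvm | hvm
        · exact hDn j v hv hj hvm
        · rcases hor (κ' j).1 with hk | hk
          · have h3 := hDn j (v ⊓ m0) (le_inf hv hj) hj inf_le_right
            rwa [inf_assoc, inf_eq_right.mpr hk] at h3
          · exact hUp j v hv hk hvm
      · rcases hbig j hj with he | hk
        · have he' : j = ⟨j0, hj0⟩ := Subtype.ext he
          subst he'
          rw [hκ0]
          have hv' : j0 ≤ v := hv
          refine ⟨lt_of_le_of_ne le_sup_left fun h => hnot (v ⊓ m0) inf_le_right
            (by rw [h]; exact le_sup_right), ?_⟩
          intro z h1 h2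
          rcases hor z with h | h
          · refine absurd h1 (not_lt_of_ge (le_inf ?_ h))
            exact h2.le.trans (sup_le inf_le_left hv')
          · exact absurd h2 (not_lt_of_ge (sup_le h1.le h))
        · exact hUp j v hv hk (hj.trans hv)

/-- `Row(x) ≤ x` iff `D_L(x)` is an independent dominating set of the
undirected Galois graph; consequently the number of such `x`, the sizes of the images of
`Pop↓` and `Pop↑`, and the number of independent dominating sets all coincide. -/
theorem stmt19 {α : Type u} [CompleteLattice α] [Finite α]
    (hsd : Semidistrim α)
    (κ : {j : α // JoinIrred j} → {m : α // MeetIrred m})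
    (hκ : IsPairing κ) (huniq : ∀ κ', IsPairing κ' → κ' = κ)
    (Row RowInv : α → α)
    (hRow : ∀ x : α, ULabel κ (Row x) = DLabel κ x)
    (hInv1 : Function.LeftInverse RowInv Row)
    (hInv2 : Function.RightInverse RowInv Row) :
    (∀ x : α, Row x ≤ x ↔ IndepDom κ (DLabel κ x)) ∧
    Nat.card {x : α // Row x ≤ x} = Nat.card (Set.range (fun x : α => PopDown x)) ∧
    Nat.card (Set.range (fun x : α => PopDown x))
      = Nat.card (Set.range (fun x : α => PopUp x)) ∧
    Nat.card (Set.range (fun x : α => PopUp x))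
      = Nat.card {S : Set {j : α // JoinIrred j} // IndepDom κ S} := by
  classical
  obtain ⟨P1, P2, P3⟩ := aux_main α hsd.1 κ hκ
  have hind := hsd.2 κ hκ
  have hnl := aux_not_le hκ
  -- independence, unpacked
  have hI : ∀ S, IndepSet κ S → ∀ i ∈ S, ∀ j ∈ S, i ≠ j → i.1 ≤ (κ j).1 := by
    intro S hS i hi j hj hij
    by_contra hc
    exact hS i hi j hj ⟨hij, hc⟩
  have Dle : ∀ x b : α, (∀ j ∈ DLabel κ x, j.1 ≤ b) → x ≤ b := by
    intro x b h
    by_contra hc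
    have hlt : x ⊓ b < x := lt_of_le_of_ne inf_le_left fun e => hc (inf_eq_left.mp e)
    obtain ⟨y, h1, h2⟩ := exists_le_covBy_of_lt hlt
    obtain ⟨j, h3, h4⟩ := P1 y x h2
    exact hnl j (((le_inf h3 (h j ⟨y, h2, h3, h4⟩)).trans h1).trans h4)
  have Ule : ∀ x b : α, (∀ j ∈ ULabel κ x, b ≤ (κ j).1) → b ≤ x := by
    intro x b h
    by_contra hc
    have hlt : x < x ⊔ b := lt_of_le_of_ne le_sup_left fun e => hc (sup_eq_left.mp e.symm)
    obtain ⟨y, h1, h2⟩ := exists_covBy_le_of_lt hlt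
    obtain ⟨j, h3, h4⟩ := P1 x y h1
    exact hnl j ((h3.trans h2).trans (sup_le h4 (h j ⟨y, h1, h3, h4⟩)))
  have Dmem : ∀ x, ∀ j ∈ DLabel κ x, j.1 ≤ x := fun x j ⟨_, _, h, _⟩ => h
  have Umem : ∀ x, ∀ j ∈ ULabel κ x, x ≤ (κ j).1 := fun x j ⟨_, _, _, h⟩ => h
  have Dinj : ∀ x y, DLabel κ x = DLabel κ y → x = y := by
    intro x y h
    exact le_antisymm (Dle _ _ fun j hj => Dmem y j (h ▸ hj))
      (Dle _ _ fun j hj => Dmem x j (h ▸ hj))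
  have Uinj : ∀ x y, ULabel κ x = ULabel κ y → x = y := by
    intro x y h
    exact le_antisymm (Ule _ _ fun j hj => Umem x j (h ▸ hj))
      (Ule _ _ fun j hj => Umem y j (h ▸ hj))
  have PopD1 : ∀ x, ∀ j ∈ DLabel κ x, PopDown x ≤ (κ j).1 := by
    rintro x j ⟨y, h1, h2, h3⟩
    have h4 : sInf {y : α | y ⋖ x} ≤ y := sInf_le h1
    exact (inf_le_right.trans h4).trans h3
  have PopD2 : ∀ x b, b ≤ x → (∀ j ∈ DLabel κ x, b ≤ (κ j).1) → b ≤ PopDown x := by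
    intro x b hb h
    refine le_inf hb (le_sInf ?_)
    intro y hy
    obtain ⟨j, h3, h4⟩ := P1 y x hy
    have h5 := h j ⟨y, hy, h3, h4⟩
    have h6 : y ⊔ b ≤ (κ j).1 := sup_le h4 h5
    by_contra hc
    have hlt : y < y ⊔ b := lt_of_le_of_ne le_sup_left fun e => hc (sup_eq_left.mp e.symm)
    have : y ⊔ b = x := (hy.eq_or_eq hlt.le (sup_le hy.1.le hb)).resolve_left hlt.ne'
    exact hnl j (h3.trans (this ▸ h6))
  have PopU1 : ∀ x, ∀ j ∈ ULabel κ x, j.1 ≤ PopUp x := by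
    rintro x j ⟨y, h1, h2, h3⟩
    have h4 : y ≤ sSup {y : α | x ⋖ y} := le_sSup h1
    exact h2.trans (h4.trans le_sup_right)
  have PopU2 : ∀ x b, x ≤ b → (∀ j ∈ ULabel κ x, j.1 ≤ b) → PopUp x ≤ b := by
    intro x b hb h
    refine sup_le hb (sSup_le ?_)
    intro y hy
    obtain ⟨j, h3, h4⟩ := P1 x y hy
    have h5 := h j ⟨y, hy, h3, h4⟩
    have h6 : j.1 ≤ y ⊓ b := le_inf h3 h5
    by_contra hc
    have hlt : y ⊓ b < y := lt_of_le_of_ne inf_le_left fun e => hc (inf_eq_left.mp e)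
    have : y ⊓ b = x := (hy.eq_or_eq (le_inf hy.1.le hb) hlt.le).resolve_right hlt.ne
    exact hnl j ((this ▸ h6).trans h4)
  have PopDle : ∀ x : α, PopDown x ≤ x := fun x => inf_le_left
  have PopUle : ∀ x : α, x ≤ PopUp x := fun x => le_sup_left
  have DU : ∀ x, DLabel κ x ⊆ ULabel κ (PopDown x) := by
    intro x j hj
    have h1 := P2 j (PopDown x) (PopD1 x j hj)
    have h2 : (PopDown x ⊔ j.1) ⊓ (κ j).1 = PopDown x := by
      refine le_antisymm (PopD2 x _ ?_ ?_) (le_inf le_sup_left (PopD1 x j hj))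
      · exact inf_le_left.trans (sup_le (PopDle x) (Dmem x j hj))
      · intro i hi
        by_cases hij : j = i
        · subst hij; exact inf_le_right
        · exact inf_le_left.trans
            (sup_le (PopD1 x i hi) (hI _ (hind x).1 j hj i hi hij))
    rw [h2] at h1
    exact ⟨_, h1, le_sup_right, PopD1 x j hj⟩
  have UD : ∀ x, ULabel κ x ⊆ DLabel κ (PopUp x) := by
    intro x j hj
    have h1 := P3 j (PopUp x) (PopU1 x j hj)
    have h2 : (PopUp x ⊓ (κ j).1) ⊔ j.1 = PopUp x := by
      refine le_antisymm (sup_le inf_le_left (PopU1 x j hj)) (PopU2 x _ ?_ ?_)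
      · exact (le_inf (PopUle x) (Umem x j hj)).trans le_sup_left
      · intro i hi
        by_cases hij : i = j
        · subst hij; exact le_sup_right
        · exact (le_inf (PopU1 x i hi) (hI _ (hind x).2 i hi j hj hij)).trans le_sup_left
    rw [h2] at h1
    exact ⟨_, h1, PopU1 x j hj, inf_le_right⟩
  have Dsurj : ∀ S, IndepSet κ S → ∃ x, DLabel κ x = S := by
    intro S hS
    let x : α := sSup (Subtype.val '' S)
    have hmem : ∀ i ∈ S, i.1 ≤ x := fun i hi => le_sSup ⟨i, hi, rfl⟩
    have hle : ∀ b, (∀ i ∈ S, i.1 ≤ b) → x ≤ b := by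
      intro b h
      refine sSup_le ?_
      rintro _ ⟨i, hi, rfl⟩
      exact h i hi
    have hsub : S ⊆ DLabel κ x := by
      intro j hj
      have h1 := P3 j x (hmem j hj)
      have h2 : (x ⊓ (κ j).1) ⊔ j.1 = x := by
        refine le_antisymm (sup_le inf_le_left (hmem j hj)) (hle _ ?_)
        intro i hi
        by_cases hij : i = j
        · subst hij; exact le_sup_right
        · exact (le_inf (hmem i hi) (hI _ hS i hi j hj hij)).trans le_sup_left
      rw [h2] at h1
      exact ⟨_, h1, hmem j hj, inf_le_right⟩
    refine ⟨x, Set.Subset.antisymm ?_ hsub⟩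
    intro j hj
    by_contra hjS
    refine hnl j ((Dmem x j hj).trans (hle _ ?_))
    intro i hi
    exact hI _ (hind x).1 i (hsub hi) j hj fun e => hjS (e ▸ hi)
  have RowLe : ∀ x, ∀ j ∈ DLabel κ x, Row x ≤ (κ j).1 := by
    intro x j hj
    exact Umem _ j (by rw [hRow]; exact hj)
  have leRow : ∀ x b, (∀ j ∈ DLabel κ x, b ≤ (κ j).1) → b ≤ Row x := by
    intro x b h
    exact Ule _ _ (by rw [hRow]; exact h)
  have A : ∀ x : α, Row x ≤ x ↔ IndepDom κ (DLabel κ x) := by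
    intro x
    constructor
    · intro h
      refine ⟨(hind x).1, ?_⟩
      intro j hj
      by_contra hc
      push Not at hc
      have h1 : j.1 ≤ Row x := by
        refine leRow x _ fun i hi => ?_
        by_contra hn
        exact (hc i hi).1 ⟨fun e => hj (e ▸ hi), hn⟩
      have h2 : x ≤ (κ j).1 := by
        refine Dle x _ fun i hi => ?_
        by_contra hn
        exact (hc i hi).2 ⟨fun e => hj (e ▸ hi), hn⟩
      exact hnl j ((h1.trans h).trans h2)
    · rintro ⟨-, hdom⟩
      have h1 : ULabel κ (PopDown x) = DLabel κ x := by
        refine Set.Subset.antisymm ?_ (DU x)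
        intro j hj
        by_contra hjn
        obtain ⟨i, hi, h | h⟩ := hdom j hjn
        · exact (hind (PopDown x)).2 j hj i (DU x hi) h
        · exact (hind (PopDown x)).2 i (DU x hi) j hj h
      have h2 : PopDown x = Row x := Uinj _ _ (h1.trans (hRow x).symm)
      rw [← h2]; exact PopDle x
  have hRinj : Function.Injective Row := hInv1.injective
  have E1 : Set.range (fun x : α => PopDown x) = Row '' {x | Row x ≤ x} := by
    ext y
    constructor
    · rintro ⟨x, rfl⟩
      refine ⟨RowInv (PopDown x), ?_, hInv2 _⟩
      show Row (RowInv (PopDown x)) ≤ _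
      rw [hInv2 (PopDown x)]
      refine (PopDle x).trans (Dle x _ fun j hj => Dmem _ j ?_)
      rw [← hRow, hInv2 (PopDown x)]
      exact DU x hj
    · rintro ⟨x, hx, rfl⟩
      refine ⟨x, le_antisymm ?_ ?_⟩
      · exact leRow x _ (PopD1 x)
      · exact PopD2 x _ hx (RowLe x)
  have E2 : Set.range (fun x : α => PopUp x) = {x | Row x ≤ x} := by
    ext x
    constructor
    · rintro ⟨z, rfl⟩
      refine le_trans (Ule z _ fun j hj => ?_) (PopUle z)
      exact RowLe (PopUp z) j (UD z hj)
    · intro hx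
      refine ⟨Row x, le_antisymm ?_ ?_⟩
      · refine PopU2 _ _ hx ?_
        rw [hRow]; exact Dmem x
      · refine Dle x _ fun j hj => PopU1 _ j ?_
        rw [hRow]; exact hj
  have C1 : Nat.card {x : α // Row x ≤ x} = Nat.card (Set.range (fun x : α => PopDown x)) := by
    rw [E1, Nat.card_image_of_injective hRinj]
    rfl
  have C2 : Nat.card (Set.range (fun x : α => PopUp x)) = Nat.card {x : α // Row x ≤ x} := by
    rw [E2]
    rfl
  refine ⟨A, C1, C1.symm.trans C2.symm, C2.trans ?_⟩
  refine Nat.card_congr (Equiv.ofBijective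
    (fun x : {x : α // Row x ≤ x} => (⟨DLabel κ x.1, (A x.1).mp x.2⟩ :
      {S : Set {j : α // JoinIrred j} // IndepDom κ S})) ⟨?_, ?_⟩)
  · intro x y hxy
    exact Subtype.ext (Dinj _ _ (congrArg Subtype.val hxy))
  · rintro ⟨S, hS⟩
    obtain ⟨x, rfl⟩ := Dsurj S hS.1
    exact ⟨⟨x, (A x).mpr hS⟩, rfl⟩
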